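/- Let m_1, m_2, α ∈ ℝ, ρ_1, ρ_2 > 0, and p ∈ [0, 1/2]. Let P be the joint probability mass function on {1, 2}² with P(1,1) = P(2,2) = p and P(1,2) = P(2,1) = 1/2 − p, and let h(y, y′) = Σ_{k,k′} P(k, k′) vM(y | m_k, ρ_k) vM(y′ | m_{k′}, ρ_{k′}) on [0, 2π)². Writing c_k = I_1(ρ_k)/I_0(ρ_k), we have 2 E_h[sin(y−α)sin(y′−α)] = 2 ∫∫ sin(y − α) sin(y′ − α) h(y, y′) dy dy′ = p c_1² (1 − cos(2(m_1 − α))) + p c_2² (1 − cos(2(m_2 − α))) + (1 − 2p) c_1 c_2 ( cos(m_1 − m_2) − cos(m_1 + m_2 − 2α) ). -/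

import Mathlib

open MeasureTheory

/-- modified Bessel function of the first kind of integer order -/
noncomputable def besselI (n : ℕ) (ρ : ℝ) : ℝ :=
  (1 / (2 * Real.pi)) * ∫ y in (0:ℝ)..(2 * Real.pi), Real.cos (n * y) * Real.exp (ρ * Real.cos y)

/-- von Mises density with mean angle m and concentration ρ -/
noncomputable def vM (y m ρ : ℝ) : ℝ :=
  Real.exp (ρ * Real.cos (y - m)) / (2 * Real.pi * besselI 0 ρ)

open intervalIntegral in
lemma integral_sin_mul_exp_cos (ρ : ℝ) :
    ∫ y in (0:ℝ)..(2 * Real.pi), Real.sin y * Real.exp (ρ * Real.cos y) = 0 := by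
  have key := integral_comp_sub_left (a := 0) (b := 2 * Real.pi)
    (fun y => Real.sin y * Real.exp (ρ * Real.cos y)) (2 * Real.pi)
  simp only [Real.sin_two_pi_sub, Real.cos_two_pi_sub, neg_mul, intervalIntegral.integral_neg,
    sub_self, sub_zero] at key
  linarith

open intervalIntegral in
lemma integral_sin_sub_mul_exp_cos_sub (m α ρ : ℝ) :
    ∫ y in (0:ℝ)..(2 * Real.pi), Real.sin (y - α) * Real.exp (ρ * Real.cos (y - m))
      = Real.sin (m - α) *
        ∫ y in (0:ℝ)..(2 * Real.pi), Real.cos y * Real.exp (ρ * Real.cos y) := by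
  let g : ℝ → ℝ := fun u => Real.sin (u + (m - α)) * Real.exp (ρ * Real.cos u)
  have hg : Function.Periodic g (2 * Real.pi) := fun u => by
    simp only [g, add_right_comm u, Real.sin_add_two_pi, Real.cos_add_two_pi]
  calc ∫ y in (0:ℝ)..(2 * Real.pi), Real.sin (y - α) * Real.exp (ρ * Real.cos (y - m))
      = ∫ y in (0:ℝ)..(2 * Real.pi), g (y - m) := by simp [g]
    _ = ∫ u in (-m)..(-m + 2 * Real.pi), g u := by
        rw [integral_comp_sub_right]
        congr 1 <;> ring
    _ = ∫ u in (0:ℝ)..(2 * Real.pi), g u := by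
        simpa using hg.intervalIntegral_add_eq (-m) 0
    _ = ∫ u in (0:ℝ)..(2 * Real.pi),
          (Real.cos (m - α) * (Real.sin u * Real.exp (ρ * Real.cos u)) +
            Real.sin (m - α) * (Real.cos u * Real.exp (ρ * Real.cos u))) := by
        refine integral_congr fun u _ => ?_
        simp only [g, Real.sin_add]
        ring
    _ = _ := by
        rw [integral_add (Continuous.intervalIntegrable (by fun_prop) _ _)
          (Continuous.intervalIntegrable (by fun_prop) _ _), intervalIntegral.integral_const_mul,
          intervalIntegral.integral_const_mul, integral_sin_mul_exp_cos]
        ring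

lemma integral_sin_sub_mul_vM (m α ρ : ℝ) :
    ∫ y in (0:ℝ)..(2 * Real.pi), Real.sin (y - α) * vM y m ρ
      = besselI 1 ρ / besselI 0 ρ * Real.sin (m - α) := by
  simp only [vM, ← mul_div_assoc]
  rw [intervalIntegral.integral_div, integral_sin_sub_mul_exp_cos_sub]
  simp only [besselI, Nat.cast_one, one_mul]
  generalize ∫ y in (0:ℝ)..(2 * Real.pi), Real.cos y * Real.exp (ρ * Real.cos y) = J
  field_simp

lemma continuous_vM (m ρ : ℝ) : Continuous fun y => vM y m ρ := by
  unfold vM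
  fun_prop

theorem stmt_15 (m₁ m₂ α ρ₁ ρ₂ p : ℝ) (hρ₁ : 0 < ρ₁) (hρ₂ : 0 < ρ₂)
    (hp : p ∈ Set.Icc (0 : ℝ) (1 / 2))
    (h : ℝ → ℝ → ℝ)
    (hdef : ∀ y y', h y y'
      = p * (vM y m₁ ρ₁ * vM y' m₁ ρ₁) + p * (vM y m₂ ρ₂ * vM y' m₂ ρ₂) +
        (1 / 2 - p) * (vM y m₁ ρ₁ * vM y' m₂ ρ₂) +
        (1 / 2 - p) * (vM y m₂ ρ₂ * vM y' m₁ ρ₁)) :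
    2 * (∫ y in (0:ℝ)..(2 * Real.pi), ∫ y' in (0:ℝ)..(2 * Real.pi),
          Real.sin (y - α) * Real.sin (y' - α) * h y y')
      = p * (besselI 1 ρ₁ / besselI 0 ρ₁) ^ 2 * (1 - Real.cos (2 * (m₁ - α))) +
        p * (besselI 1 ρ₂ / besselI 0 ρ₂) ^ 2 * (1 - Real.cos (2 * (m₂ - α))) +
        (1 - 2 * p) * ((besselI 1 ρ₁ / besselI 0 ρ₁) * (besselI 1 ρ₂ / besselI 0 ρ₂)) *
          (Real.cos (m₁ - m₂) - Real.cos (m₁ + m₂ - 2 * α)) := by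
  have hlin (f : ℝ → ℝ) (A B m n ρ σ : ℝ) (hf : Continuous f) :
      ∫ y in (0:ℝ)..(2 * Real.pi), (A * (f y * vM y m ρ) + B * (f y * vM y n σ))
        = A * (∫ y in (0:ℝ)..(2 * Real.pi), f y * vM y m ρ) +
          B * ∫ y in (0:ℝ)..(2 * Real.pi), f y * vM y n σ := by
    have h₁ := continuous_vM m ρ
    have h₂ := continuous_vM n σ
    rw [intervalIntegral.integral_add (Continuous.intervalIntegrable (by fun_prop) _ _)
      (Continuous.intervalIntegrable (by fun_prop) _ _), intervalIntegral.integral_const_mul,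
      intervalIntegral.integral_const_mul]
  have hsin : Continuous fun y => Real.sin (y - α) := by fun_prop
  have hinner (y : ℝ) : ∫ y' in (0:ℝ)..(2 * Real.pi),
      Real.sin (y - α) * Real.sin (y' - α) * h y y'
      = (p * (besselI 1 ρ₁ / besselI 0 ρ₁ * Real.sin (m₁ - α)) +
          (1 / 2 - p) * (besselI 1 ρ₂ / besselI 0 ρ₂ * Real.sin (m₂ - α))) *
            (Real.sin (y - α) * vM y m₁ ρ₁) +
        (p * (besselI 1 ρ₂ / besselI 0 ρ₂ * Real.sin (m₂ - α)) +
          (1 / 2 - p) * (besselI 1 ρ₁ / besselI 0 ρ₁ * Real.sin (m₁ - α))) *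
            (Real.sin (y - α) * vM y m₂ ρ₂) := by
    rw [← integral_sin_sub_mul_vM m₁, ← integral_sin_sub_mul_vM m₂]
    trans ∫ y' in (0:ℝ)..(2 * Real.pi),
      ((Real.sin (y - α) * (p * vM y m₁ ρ₁ + (1 / 2 - p) * vM y m₂ ρ₂)) *
          (Real.sin (y' - α) * vM y' m₁ ρ₁) +
        (Real.sin (y - α) * (p * vM y m₂ ρ₂ + (1 / 2 - p) * vM y m₁ ρ₁)) *
          (Real.sin (y' - α) * vM y' m₂ ρ₂))
    · refine intervalIntegral.integral_congr fun y' _ => ?_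
      simp only [hdef]
      ring
    · rw [hlin _ _ _ _ _ _ _ hsin]
      ring
  simp only [hinner]
  rw [hlin _ _ _ _ _ _ _ hsin, integral_sin_sub_mul_vM, integral_sin_sub_mul_vM]
  have hsq (x : ℝ) : 1 - Real.cos (2 * x) = 2 * Real.sin x ^ 2 := by
    rw [Real.cos_two_mul, Real.cos_sq']
    ring
  have hprod : Real.cos (m₁ - m₂) - Real.cos (m₁ + m₂ - 2 * α)
      = 2 * (Real.sin (m₁ - α) * Real.sin (m₂ - α)) := by
    rw [show m₁ - m₂ = (m₁ - α) - (m₂ - α) by ring,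
      show m₁ + m₂ - 2 * α = (m₁ - α) + (m₂ - α) by ring, Real.cos_sub, Real.cos_add]
    ring
  rw [hsq, hsq, hprod]
  ring
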